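/- Let ℓ ≥ 1 be an integer, L ≥ 1024 a real, X a finite set with |X| = n, p ∈ (0,1], and let w be a positive integer with Lpn ≤ w ≤ n. Let H be an ℓ-bounded hypergraph on X, and for each w-subset W of X fix a function T(·,W) assigning to each S ∈ H a minimum (S,W)-fragment; set t(S,W) = |T(S,W)|, G(W) = {S ∈ H : t(S,W) ≥ 0.9ℓ}, and U(W) = {T(S,W) : S ∈ G(W)}. Then for W chosen uniformly at random among all w-subsets of X, with probability at least 1 − L^{−0.1ℓ} one has Σ_{U ∈ U(W)} p^{|U|} < L^{−0.5ℓ}. -/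

import Mathlib

open Finset

/-- `T` is an `(S,W)`-fragment (with respect to `H`): `T = S' ∖ W` for some
`S' ∈ H` with `S' ⊆ S ∪ W`. -/
def IsFragment {α : Type*} [DecidableEq α] (H : Finset (Finset α))
    (S W T : Finset α) : Prop :=
  ∃ S' ∈ H, S' ⊆ S ∪ W ∧ T = S' \ W

/-- `T` is a minimum `(S,W)`-fragment: an `(S,W)`-fragment of minimum size. -/
def IsMinFragment {α : Type*} [DecidableEq α] (H : Finset (Finset α))
    (S W T : Finset α) : Prop :=
  IsFragment H S W T ∧ ∀ T', IsFragment H S W T' → T.card ≤ T'.card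

theorem IsFragment.subset {α : Type*} [DecidableEq α] {H : Finset (Finset α)}
    {S W T : Finset α} (h : IsFragment H S W T) : T ⊆ S := by
  obtain ⟨S', -, hS, rfl⟩ := h
  exact sdiff_le_iff.2 (hS.trans (union_comm S W).subset)

theorem IsFragment.disjoint {α : Type*} [DecidableEq α] {H : Finset (Finset α)}
    {S W T : Finset α} (h : IsFragment H S W T) : Disjoint T W := by
  obtain ⟨S', -, -, rfl⟩ := h
  exact sdiff_disjoint

theorem IsFragment.exists_subset_union {α : Type*} [DecidableEq α] {H : Finset (Finset α)}
    {S W T : Finset α} (h : IsFragment H S W T) : ∃ S' ∈ H, S' ⊆ W ∪ T := by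
  obtain ⟨S', hS', -, rfl⟩ := h
  exact ⟨S', hS', by simp⟩

/-- A minimum fragment `T` is contained in every edge contained in `W ∪ T`. -/
theorem IsMinFragment.subset_of_subset_union {α : Type*} [DecidableEq α]
    {H : Finset (Finset α)} {S W T A : Finset α} (h : IsMinFragment H S W T)
    (hA : A ∈ H) (hAT : A ⊆ W ∪ T) : T ⊆ A := by
  have hfrag : IsFragment H S W (A \ W) := by
    refine ⟨A, hA, hAT.trans ?_, rfl⟩
    rw [union_comm]
    exact union_subset_union_left h.1.subset
  have hsub : A \ W ⊆ T := sdiff_le_iff.2 hAT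
  rw [← eq_of_subset_of_card_le hsub (h.2 _ hfrag)]
  exact sdiff_subset

theorem exists_contained_edge_choice {α : Type*} [DecidableEq α]
    (H : Finset (Finset α)) {ℓ : ℕ} (hbd : ∀ S ∈ H, S.card ≤ ℓ) :
    ∃ e : Finset α → Finset α, (∀ Z, (e Z).card ≤ ℓ) ∧
      ∀ Z, (∃ S ∈ H, S ⊆ Z) → e Z ∈ H ∧ e Z ⊆ Z := by
  have key : ∀ Z : Finset α, ∃ A : Finset α, A.card ≤ ℓ ∧
      ((∃ S ∈ H, S ⊆ Z) → A ∈ H ∧ A ⊆ Z) := by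
    intro Z
    by_cases h : ∃ S ∈ H, S ⊆ Z
    · obtain ⟨S, hS, hSZ⟩ := h
      exact ⟨S, hbd S hS, fun _ => ⟨hS, hSZ⟩⟩
    · exact ⟨∅, by simp, fun h' => absurd h' h⟩
  choose e he using key
  exact ⟨e, fun Z => (he Z).1, fun Z => (he Z).2⟩

/-- If every `T ∈ U W` is disjoint from `W` and contained in `e (W ∪ T)`, a set of size at
most `ℓ` depending only on the union, the pairs `(W, T)` can be counted through `W ∪ T`. -/
theorem sum_cost_le {α : Type*} [Fintype α] [DecidableEq α] {ℓ w : ℕ} {p : ℝ}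
    (hp : 0 ≤ p) (a : ℝ) (e : Finset α → Finset α) (he : ∀ Z, (e Z).card ≤ ℓ)
    (U : Finset α → Finset (Finset α))
    (hU : ∀ W ∈ (univ : Finset α).powersetCard w, ∀ T ∈ U W,
      Disjoint T W ∧ T ⊆ e (W ∪ T) ∧ a ≤ (T.card : ℝ)) :
    ∑ W ∈ (univ : Finset α).powersetCard w, ∑ T ∈ U W, p ^ T.card ≤
      ∑ m ∈ (range (ℓ + 1)).filter (fun m : ℕ => a ≤ (m : ℝ)),
        ((Fintype.card α).choose (w + m) : ℝ) * (ℓ.choose m : ℝ) * p ^ m := by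
  let I := (range (ℓ + 1)).filter (fun m : ℕ => a ≤ (m : ℝ))
  let P : Finset (Σ _ : Finset α, Finset α) := ((univ : Finset α).powersetCard w).sigma U
  let Q : Finset (Σ _ : ℕ, Σ _ : Finset α, Finset α) :=
    I.sigma fun m => ((univ : Finset α).powersetCard (w + m)).sigma fun Z =>
      (e Z).powersetCard m
  let g : (Σ _ : Finset α, Finset α) → (Σ _ : ℕ, Σ _ : Finset α, Finset α) :=
    fun x => ⟨x.2.card, x.1 ∪ x.2, x.2⟩
  have hg : Set.InjOn g P := by
    rintro ⟨W, T⟩ hx ⟨W', T'⟩ hy hxy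
    have hx' := mem_sigma.1 (mem_coe.1 hx)
    have hy' := mem_sigma.1 (mem_coe.1 hy)
    have h1 := (hU W hx'.1 T hx'.2).1
    have h2 := (hU W' hy'.1 T' hy'.2).1
    simp only [g, Sigma.mk.injEq, heq_eq_eq] at hxy
    obtain ⟨-, hZ, rfl⟩ := hxy
    have : W = W' := by
      rw [← union_sdiff_cancel_right h1.symm, hZ, union_sdiff_cancel_right h2.symm]
    rw [this]
  have hPQ : P.image g ⊆ Q := by
    intro y hy
    obtain ⟨⟨W, T⟩, hx, rfl⟩ := mem_image.1 hy
    have hx' := mem_sigma.1 hx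
    obtain ⟨hd, hs, ha⟩ := hU W hx'.1 T hx'.2
    have hc := (mem_powersetCard.1 hx'.1).2
    have hle := (card_le_card hs).trans (he _)
    simp only [Q, I, g, mem_sigma, mem_filter, mem_range, mem_powersetCard]
    refine ⟨⟨by omega, ha⟩, ⟨subset_univ _, ?_⟩, hs, trivial⟩
    rw [card_union_of_disjoint hd.symm, hc]
  calc ∑ W ∈ (univ : Finset α).powersetCard w, ∑ T ∈ U W, p ^ T.card
      = ∑ x ∈ P, p ^ (g x).1 := by rw [sum_sigma]
    _ = ∑ y ∈ P.image g, p ^ y.1 := by rw [sum_image hg]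
    _ ≤ ∑ y ∈ Q, p ^ y.1 :=
        sum_le_sum_of_subset_of_nonneg hPQ fun _ _ _ => by positivity
    _ = ∑ m ∈ I, ∑ Z ∈ (univ : Finset α).powersetCard (w + m),
          ((e Z).card.choose m : ℝ) * p ^ m := by
        simp only [Q, sum_sigma, sum_const, card_sigma, card_powersetCard, nsmul_eq_mul,
          Nat.cast_sum, sum_mul]
    _ ≤ ∑ m ∈ I, ∑ Z ∈ (univ : Finset α).powersetCard (w + m),
          (ℓ.choose m : ℝ) * p ^ m := by
        gcongr with m _ Z _
        exact he Z
    _ = _ := by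
        simp only [sum_const, card_powersetCard, nsmul_eq_mul, card_univ, mul_assoc, I]

theorem choose_add_mul_pow_le (n w m : ℕ) :
    n.choose (w + m) * w ^ m ≤ n.choose w * n ^ m := by
  induction m with
  | zero => simp
  | succ m ih =>
    calc n.choose (w + (m + 1)) * w ^ (m + 1)
        = n.choose (w + m + 1) * w * w ^ m := by rw [← add_assoc, pow_succ]; ring
      _ ≤ n.choose (w + m + 1) * (w + m + 1) * w ^ m := by gcongr; omega
      _ = n.choose (w + m) * w ^ m * (n - (w + m)) := by
          rw [Nat.choose_succ_right_eq]; ring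
      _ ≤ n.choose w * n ^ m * n := by gcongr; omega
      _ = n.choose w * n ^ (m + 1) := by ring

theorem choose_add_mul_pow_le_of_mul_le {n w : ℕ} {L p : ℝ} (hn : 0 < n) (hL : 0 < L)
    (hp : 0 ≤ p) (h : L * p * n ≤ w) (m : ℕ) :
    (n.choose (w + m) : ℝ) * p ^ m ≤ (n.choose w : ℝ) * (L ^ m)⁻¹ := by
  have hn' : (0 : ℝ) < n := by exact_mod_cast hn
  have h1 : (n.choose (w + m) : ℝ) * (w : ℝ) ^ m ≤ n.choose w * (n : ℝ) ^ m := by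
    exact_mod_cast choose_add_mul_pow_le n w m
  have h2 : (n.choose (w + m) : ℝ) * (L * p * n) ^ m ≤ n.choose w * (n : ℝ) ^ m :=
    le_trans (by gcongr) h1
  rw [← div_eq_mul_inv, le_div_iff₀ (by positivity)]
  refine le_of_mul_le_mul_right ?_ (pow_pos hn' m)
  calc _ = (n.choose (w + m) : ℝ) * (L * p * n) ^ m := by ring
    _ ≤ _ := h2

/-- Lemma 2.1: for `W` uniformly random among `w`-subsets of `X`, with probability at
least `1 - L^{-0.1ℓ}` the cover `U(W)` is cheap: `∑_{U ∈ U(W)} p^{|U|} < L^{-0.5ℓ}`. -/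
theorem cover_cheap_whp {α : Type*} [Fintype α] [DecidableEq α]
    (ℓ : ℕ) (hℓ : 1 ≤ ℓ) (L : ℝ) (hL : 1024 ≤ L)
    (p : ℝ) (hp0 : 0 < p) (hp1 : p ≤ 1)
    (w : ℕ) (hw0 : 0 < w) (hwl : L * p * (Fintype.card α : ℝ) ≤ (w : ℝ))
    (hwn : w ≤ Fintype.card α)
    (H : Finset (Finset α)) (hbd : ∀ S ∈ H, S.card ≤ ℓ)
    (TW : Finset α → Finset α → Finset α)
    (hTW : ∀ W ∈ (Finset.univ : Finset α).powersetCard w,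
      ∀ S ∈ H, IsMinFragment H S W (TW W S)) :
    (1 - L ^ (-(0.1 : ℝ) * (ℓ : ℝ))) * ((Fintype.card α).choose w : ℝ)
      ≤ ((((Finset.univ : Finset α).powersetCard w).filter fun W =>
          ∑ U ∈ (H.filter fun S => (0.9 : ℝ) * (ℓ : ℝ) ≤ ((TW W S).card : ℝ)).image (TW W),
            p ^ U.card < L ^ (-(0.5 : ℝ) * (ℓ : ℝ))).card : ℝ) := by
  have hL0 : 0 < L := by linarith
  have hn : 0 < Fintype.card α := by omega
  set N : ℝ := ((Fintype.card α).choose w : ℝ) with hN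
  set 𝒲 := (univ : Finset α).powersetCard w
  let U : Finset α → Finset (Finset α) := fun W =>
    (H.filter fun S => (0.9 : ℝ) * (ℓ : ℝ) ≤ ((TW W S).card : ℝ)).image (TW W)
  let f : Finset α → ℝ := fun W => ∑ T ∈ U W, p ^ T.card
  obtain ⟨e, he, heH⟩ := exists_contained_edge_choice H hbd
  have hexp : ∑ W ∈ 𝒲, f W ≤ N * L ^ (-(0.9 : ℝ) * ℓ) * 2 ^ ℓ := by
    calc ∑ W ∈ 𝒲, f W
        ≤ ∑ m ∈ (range (ℓ + 1)).filter (fun m : ℕ => (0.9 : ℝ) * ℓ ≤ (m : ℝ)),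
          ((Fintype.card α).choose (w + m) : ℝ) * (ℓ.choose m : ℝ) * p ^ m := by
          refine sum_cost_le hp0.le _ e he U fun W hW T hT => ?_
          obtain ⟨S, hS, rfl⟩ := mem_image.1 hT
          have hS' := mem_filter.1 hS
          have hmin := hTW W hW S hS'.1
          obtain ⟨h1, h2⟩ := heH _ hmin.1.exists_subset_union
          exact ⟨hmin.1.disjoint, hmin.subset_of_subset_union h1 h2, hS'.2⟩
      _ ≤ ∑ m ∈ (range (ℓ + 1)).filter (fun m : ℕ => (0.9 : ℝ) * ℓ ≤ (m : ℝ)),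
          N * L ^ (-(0.9 : ℝ) * ℓ) * (ℓ.choose m : ℝ) := by
          refine sum_le_sum fun m hm => ?_
          have hm' := (mem_filter.1 hm).2
          have h1 := choose_add_mul_pow_le_of_mul_le hn hL0 hp0.le hwl m
          have h2 : (L ^ m)⁻¹ ≤ L ^ (-(0.9 : ℝ) * ℓ) := by
            rw [← Real.rpow_natCast, ← Real.rpow_neg hL0.le]
            exact Real.rpow_le_rpow_of_exponent_le (by linarith) (by linarith)
          calc _ = ((Fintype.card α).choose (w + m) : ℝ) * p ^ m * (ℓ.choose m : ℝ) := by ring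
            _ ≤ N * (L ^ m)⁻¹ * (ℓ.choose m : ℝ) := by gcongr
            _ ≤ _ := by gcongr
      _ ≤ ∑ m ∈ range (ℓ + 1), N * L ^ (-(0.9 : ℝ) * ℓ) * (ℓ.choose m : ℝ) :=
          sum_le_sum_of_subset_of_nonneg (filter_subset _ _) fun _ _ _ => by positivity
      _ = N * L ^ (-(0.9 : ℝ) * ℓ) * 2 ^ ℓ := by
          rw [← mul_sum]
          congr 1
          exact_mod_cast Nat.sum_range_choose ℓ
  have hpow : L ^ (-(0.9 : ℝ) * ℓ) * 2 ^ ℓ ≤ L ^ (-(0.1 : ℝ) * ℓ) * L ^ (-(0.5 : ℝ) * ℓ) := by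
    have h2 : (2 : ℝ) ≤ L ^ (0.3 : ℝ) := by
      calc (2 : ℝ) ≤ 2 ^ (3 : ℝ) := by norm_num
        _ = (1024 : ℝ) ^ (0.3 : ℝ) := by
            rw [show (1024 : ℝ) = 2 ^ (10 : ℝ) by norm_num, ← Real.rpow_mul (by norm_num)]
            norm_num
        _ ≤ L ^ (0.3 : ℝ) := by gcongr
    calc L ^ (-(0.9 : ℝ) * ℓ) * 2 ^ ℓ ≤ L ^ (-(0.9 : ℝ) * ℓ) * (L ^ (0.3 : ℝ)) ^ ℓ := by gcongr
      _ = L ^ (-(0.9 : ℝ) * ℓ + 0.3 * ℓ) := by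
          rw [← Real.rpow_natCast, ← Real.rpow_mul hL0.le, ← Real.rpow_add hL0]
      _ = L ^ (-(0.1 : ℝ) * ℓ) * L ^ (-(0.5 : ℝ) * ℓ) := by
          rw [← Real.rpow_add hL0]
          congr 1
          ring
  set c := L ^ (-(0.5 : ℝ) * (ℓ : ℝ))
  have hc0 : 0 < c := Real.rpow_pos_of_pos hL0 _
  have hmarkov : ((𝒲.filter fun W => ¬ f W < c).card : ℝ) * c ≤ ∑ W ∈ 𝒲, f W := by
    rw [← nsmul_eq_mul]
    refine (card_nsmul_le_sum _ f c fun W hW => not_lt.1 (mem_filter.1 hW).2).trans ?_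
    exact sum_le_sum_of_subset_of_nonneg (filter_subset _ _) fun W _ _ =>
      sum_nonneg fun _ _ => by positivity
  have hbad : ((𝒲.filter fun W => ¬ f W < c).card : ℝ) ≤ N * L ^ (-(0.1 : ℝ) * ℓ) := by
    refine le_of_mul_le_mul_right ?_ hc0
    calc _ ≤ N * L ^ (-(0.9 : ℝ) * ℓ) * 2 ^ ℓ := hmarkov.trans hexp
      _ = N * (L ^ (-(0.9 : ℝ) * ℓ) * 2 ^ ℓ) := by ring
      _ ≤ N * (L ^ (-(0.1 : ℝ) * ℓ) * c) := by gcongr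
      _ = _ := by ring
  have hsplit : ((𝒲.filter fun W => f W < c).card : ℝ) +
      ((𝒲.filter fun W => ¬ f W < c).card : ℝ) = N := by
    rw [hN, ← card_univ, ← card_powersetCard]
    exact_mod_cast card_filter_add_card_filter_not (s := 𝒲) fun W => f W < c
  change _ ≤ ((𝒲.filter fun W => f W < c).card : ℝ)
  linarith
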